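/- arXiv:2109.08398 — 9 statements merged into one kernel-verified Lean document; each statement's English description precedes it below -/
import Mathlib

section
/- The order function on the separations of X is submodular: for all separations (A₁,B₁) and (A₂,B₂) of X one has |A₁ ∪ A₂, B₁ ∩ B₂|_X + |A₁ ∩ A₂, B₁ ∪ B₂|_X ≤ |A₁,B₁|_X + |A₂,B₂|_X. -/
open Finset

namespace BipSep

variable {X Y : Type*} [Fintype X] [Fintype Y] [DecidableEq X] [DecidableEq Y]

/-- `|N(y) ∩ A|`: the number of neighbours of `y` in `A ⊆ X`, where the bipartite graph is
given by the adjacency relation `R : X → Y → Prop`. -/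
def nX (R : X → Y → Prop) [∀ x y, Decidable (R x y)] (y : Y) (A : Finset X) : ℕ :=
  (A.filter fun x => R x y).card

/-- `|N(x) ∩ C|` for `C ⊆ Y`. -/
def nY (R : X → Y → Prop) [∀ x y, Decidable (R x y)] (x : X) (C : Finset Y) : ℕ :=
  (C.filter fun y => R x y).card

/-- The order `|A,B|_X` of a separation `(A,B)` of `X`. -/
def ordX (R : X → Y → Prop) [∀ x y, Decidable (R x y)] (A B : Finset X) : ℚ :=
  ∑ y : Y, ((min (nX R y A) (nX R y B) : ℚ) - (nX R y (A ∩ B) : ℚ) / 2)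

/-- The order `|C,D|_Y` of a separation `(C,D)` of `Y`. -/
def ordY (R : X → Y → Prop) [∀ x y, Decidable (R x y)] (C D : Finset Y) : ℚ :=
  ∑ x : X, ((min (nY R x C) (nY R x D) : ℚ) - (nY R x (C ∩ D) : ℚ) / 2)

/-- `A^▷_B := {y ∈ Y : |N(y) ∩ A| ≥ |N(y) ∩ B|}`. -/
def shiftR1 (R : X → Y → Prop) [∀ x y, Decidable (R x y)] (A B : Finset X) : Finset Y :=
  univ.filter fun y => nX R y B ≤ nX R y A

/-- `B^▷_A := {y ∈ Y : |N(y) ∩ A| ≤ |N(y) ∩ B|}`. -/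
def shiftR2 (R : X → Y → Prop) [∀ x y, Decidable (R x y)] (A B : Finset X) : Finset Y :=
  univ.filter fun y => nX R y A ≤ nX R y B

/-- `C^◁_D := {x ∈ X : |N(x) ∩ C| ≥ |N(x) ∩ D|}`. -/
def shiftL1 (R : X → Y → Prop) [∀ x y, Decidable (R x y)] (C D : Finset Y) : Finset X :=
  univ.filter fun x => nY R x D ≤ nY R x C

/-- `D^◁_C := {x ∈ X : |N(x) ∩ C| ≤ |N(x) ∩ D|}`. -/
def shiftL2 (R : X → Y → Prop) [∀ x y, Decidable (R x y)] (C D : Finset Y) : Finset X :=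
  univ.filter fun x => nY R x C ≤ nY R x D

instance (R : X → Y → Prop) [∀ x y, Decidable (R x y)] :
    DecidablePred fun p : X × Y => R p.1 p.2 :=
  fun p => inferInstanceAs (Decidable (R p.1 p.2))

/-- The edge set of the bipartite graph with adjacency relation `R`: an edge is a pair
`(x,y)` with `x ∈ X`, `y ∈ Y` and `x` adjacent to `y`. -/
abbrev Edge (R : X → Y → Prop) := {p : X × Y // R p.1 p.2}

/-- `|E(x) ∩ C|` for a set `C` of edges. -/
def eX (R : X → Y → Prop) [∀ x y, Decidable (R x y)] (x : X) (C : Finset (Edge R)) : ℕ :=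
  (C.filter fun e => e.1.1 = x).card

/-- `|E(y) ∩ C|` for a set `C` of edges. -/
def eY (R : X → Y → Prop) [∀ x y, Decidable (R x y)] (y : Y) (C : Finset (Edge R)) : ℕ :=
  (C.filter fun e => e.1.2 = y).card

/-- The order `|C,D|_E` of a separation `(C,D)` of the edge set `E`. -/
def ordE (R : X → Y → Prop) [∀ x y, Decidable (R x y)] (C D : Finset (Edge R)) : ℚ :=
  (∑ x : X, ((min (eX R x C) (eX R x D) : ℚ) - (eX R x (C ∩ D) : ℚ) / 2)) +
    ∑ y : Y, ((min (eY R y C) (eY R y D) : ℚ) - (eY R y (C ∩ D) : ℚ) / 2)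

/-- `C^◀_D := {x ∈ X : |E(x) ∩ C| ≥ |E(x) ∩ D|}`. -/
def bshift1 (R : X → Y → Prop) [∀ x y, Decidable (R x y)] (C D : Finset (Edge R)) : Finset X :=
  univ.filter fun x => eX R x D ≤ eX R x C

/-- `D^◀_C := {x ∈ X : |E(x) ∩ C| ≤ |E(x) ∩ D|}`. -/
def bshift2 (R : X → Y → Prop) [∀ x y, Decidable (R x y)] (C D : Finset (Edge R)) : Finset X :=
  univ.filter fun x => eX R x C ≤ eX R x D

/-- `E(A)`: the set of edges with an endpoint in `A ⊆ X`. -/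
def edgesOf (R : X → Y → Prop) [∀ x y, Decidable (R x y)] (A : Finset X) : Finset (Edge R) :=
  univ.filter fun e => e.1.1 ∈ A

/-- `|E(S,T)|`: the number of edges with `X`-endpoint in `T` and `Y`-endpoint in `S`. -/
def eCount (R : X → Y → Prop) [∀ x y, Decidable (R x y)] (T : Finset X) (S : Finset Y) : ℕ :=
  (univ.filter fun e : Edge R => e.1.1 ∈ T ∧ e.1.2 ∈ S).card

/-- `S_k`: the set of oriented separations of order `< k`, with respect to the
order function `ord`. -/
def Sk {V : Type*} [Fintype V] [DecidableEq V] (ord : Finset V → Finset V → ℚ) (k : ℚ) :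
    Set (Finset V × Finset V) :=
  {p | p.1 ∪ p.2 = univ ∧ ord p.1 p.2 < k}

/-- A tangle of `S_k`: a set of oriented separations, all of order `< k`, containing exactly
one of `(A,B)`, `(B,A)` for every separation of order `< k`, such that no three of its
members have their left-hand sides covering the whole ground set. -/
def IsTangle {V : Type*} [Fintype V] [DecidableEq V] (ord : Finset V → Finset V → ℚ)
    (k : ℚ) (τ : Set (Finset V × Finset V)) : Prop :=
  (∀ p ∈ τ, p.1 ∪ p.2 = univ ∧ ord p.1 p.2 < k) ∧
  (∀ A B : Finset V, A ∪ B = univ → ord A B < k → ((A, B) ∈ τ ↔ (B, A) ∉ τ)) ∧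
  ∀ p₁ ∈ τ, ∀ p₂ ∈ τ, ∀ p₃ ∈ τ, p₁.1 ∪ p₂.1 ∪ p₃.1 ≠ univ

/-- A profile of `S_k`: an orientation of `S_k` that is consistent and closed under
the profile property. -/
def IsProfile {V : Type*} [Fintype V] [DecidableEq V] (ord : Finset V → Finset V → ℚ)
    (k : ℚ) (P : Set (Finset V × Finset V)) : Prop :=
  (∀ p ∈ P, p.1 ∪ p.2 = univ ∧ ord p.1 p.2 < k) ∧
  (∀ A B : Finset V, A ∪ B = univ → ord A B < k → ((A, B) ∈ P ↔ (B, A) ∉ P)) ∧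
  (∀ A₁ B₁ A₂ B₂ : Finset V, A₁ ⊆ A₂ → B₂ ⊆ B₁ →
    ¬((A₁ = A₂ ∧ B₁ = B₂) ∨ (A₁ = B₂ ∧ B₁ = A₂)) →
    ¬((B₁, A₁) ∈ P ∧ (A₂, B₂) ∈ P)) ∧
  ∀ p₁ ∈ P, ∀ p₂ ∈ P, (p₁.2 ∩ p₂.2, p₁.1 ∪ p₂.1) ∉ P

/-- A regular profile: a profile containing no separation of the form `(V,B)`. -/
def IsRegularProfile {V : Type*} [Fintype V] [DecidableEq V] (ord : Finset V → Finset V → ℚ)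
    (k : ℚ) (P : Set (Finset V × Finset V)) : Prop :=
  IsProfile ord k P ∧ ∀ B : Finset V, (univ, B) ∉ P

/-- `^▷τ`: the separations `(C,D)` of `Y` whose shift `(C,D)^◁` lies in `τ`. -/
def pullY (R : X → Y → Prop) [∀ x y, Decidable (R x y)] (τ : Set (Finset X × Finset X)) :
    Set (Finset Y × Finset Y) :=
  {q | q.1 ∪ q.2 = univ ∧ (shiftL1 R q.1 q.2, shiftL2 R q.1 q.2) ∈ τ}

/-- `^◁τ`: the separations `(A,B)` of `X` whose shift `(A,B)^▷` lies in `τ`. -/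
def pullX (R : X → Y → Prop) [∀ x y, Decidable (R x y)] (τ : Set (Finset Y × Finset Y)) :
    Set (Finset X × Finset X) :=
  {p | p.1 ∪ p.2 = univ ∧ (shiftR1 R p.1 p.2, shiftR2 R p.1 p.2) ∈ τ}

/-- `τ_E`: the separations `(C,D)` of `E` whose shift `(C,D)^◀` lies in `τ`. -/
def pullE (R : X → Y → Prop) [∀ x y, Decidable (R x y)] (τ : Set (Finset X × Finset X)) :
    Set (Finset (Edge R) × Finset (Edge R)) :=
  {q | q.1 ∪ q.2 = univ ∧ (bshift1 R q.1 q.2, bshift2 R q.1 q.2) ∈ τ}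

/-- `τ_X := {(C,D)^◀ : (C,D) ∈ τ}`. -/
def pushX (R : X → Y → Prop) [∀ x y, Decidable (R x y)]
    (τ : Set (Finset (Edge R) × Finset (Edge R))) : Set (Finset X × Finset X) :=
  {p | ∃ q ∈ τ, (bshift1 R q.1 q.2, bshift2 R q.1 q.2) = p}


omit [Fintype X] [Fintype Y] [DecidableEq X] [DecidableEq Y] in
theorem nX_mono (R : X → Y → Prop) [∀ x y, Decidable (R x y)] (y : Y) {A B : Finset X}
    (h : A ⊆ B) : nX R y A ≤ nX R y B :=
  card_le_card (filter_subset_filter _ h)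

omit [Fintype X] [Fintype Y] [DecidableEq Y] in
theorem nX_union_add_nX_inter (R : X → Y → Prop) [∀ x y, Decidable (R x y)] (y : Y)
    (A B : Finset X) : nX R y (A ∪ B) + nX R y (A ∩ B) = nX R y A + nX R y B := by
  simp only [nX, filter_union, filter_inter_distrib, card_union_add_card_inter]

omit [DecidableEq Y] in
/-- On separations of `X`, the order only depends on the differences `|N(y) ∩ A| - |N(y) ∩ B|`. -/
theorem ordX_eq_sum_sub_abs (R : X → Y → Prop) [∀ x y, Decidable (R x y)] {A B : Finset X}
    (h : A ∪ B = univ) :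
    ordX R A B = ∑ y : Y, ((nX R y univ : ℚ) - |(nX R y A : ℚ) - nX R y B|) / 2 := by
  refine sum_congr rfl fun y _ => ?_
  have hc : (nX R y univ : ℚ) + nX R y (A ∩ B) = nX R y A + nX R y B := by
    rw [← h]
    exact_mod_cast nX_union_add_nX_inter R y A B
  have hsum := min_add_max (nX R y A : ℚ) (nX R y B)
  have hdiff := max_sub_min_eq_abs' (nX R y A : ℚ) (nX R y B)
  linarith

/-- Convexity of the absolute value: spreading two numbers apart while keeping their sum does not
decrease the sum of their absolute values. -/
theorem abs_add_abs_le_of_spread {p q s t : ℚ} (hsum : s + t = p + q) (hp : p ≤ s) (hq : q ≤ s) :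
    |p| + |q| ≤ |s| + |t| := by
  grind

/-- The order function `|·|_X` on the separations of `X` is submodular. -/
theorem ordX_submodular (R : X → Y → Prop) [∀ x y, Decidable (R x y)]
    (A₁ B₁ A₂ B₂ : Finset X) (h₁ : A₁ ∪ B₁ = univ) (h₂ : A₂ ∪ B₂ = univ) :
    ordX R (A₁ ∪ A₂) (B₁ ∩ B₂) + ordX R (A₁ ∩ A₂) (B₁ ∪ B₂) ≤
      ordX R A₁ B₁ + ordX R A₂ B₂ := by
  have hsup : (A₁ ∪ A₂) ∪ (B₁ ∩ B₂) = univ := by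
    rw [union_inter_distrib_left, union_right_comm, h₁, union_assoc, h₂]
    simp
  have hinf : (A₁ ∩ A₂) ∪ (B₁ ∪ B₂) = univ := by
    rw [inter_union_distrib_right, ← union_assoc, h₁, union_left_comm, h₂]
    simp
  rw [ordX_eq_sum_sub_abs R hsup, ordX_eq_sum_sub_abs R hinf, ordX_eq_sum_sub_abs R h₁,
    ordX_eq_sum_sub_abs R h₂, ← sum_add_distrib, ← sum_add_distrib]
  refine sum_le_sum fun y _ => ?_
  have hA : (nX R y (A₁ ∪ A₂) : ℚ) + nX R y (A₁ ∩ A₂) = nX R y A₁ + nX R y A₂ :=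
    mod_cast nX_union_add_nX_inter R y A₁ A₂
  have hB : (nX R y (B₁ ∪ B₂) : ℚ) + nX R y (B₁ ∩ B₂) = nX R y B₁ + nX R y B₂ :=
    mod_cast nX_union_add_nX_inter R y B₁ B₂
  have hspread := abs_add_abs_le_of_spread
    (p := (nX R y A₁ : ℚ) - nX R y B₁) (q := (nX R y A₂ : ℚ) - nX R y B₂)
    (s := (nX R y (A₁ ∪ A₂) : ℚ) - nX R y (B₁ ∩ B₂))
    (t := (nX R y (A₁ ∩ A₂) : ℚ) - nX R y (B₁ ∪ B₂)) (by linarith)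
    (sub_le_sub (mod_cast nX_mono R y subset_union_left) (mod_cast nX_mono R y inter_subset_left))
    (sub_le_sub (mod_cast nX_mono R y subset_union_right)
      (mod_cast nX_mono R y inter_subset_right))
  linarith

end BipSep
end

section
/- Let k > 0, assume that every vertex of G is incident with at least one edge and that G has at least 8k edges. If τ is a tangle of S_{4k}(X), then τ' := ^▷τ ∩ S_k(Y) is a tangle of S_k(Y). -/
open Finset

namespace BipSep

variable {X Y : Type*} [Fintype X] [Fintype Y] [DecidableEq X] [DecidableEq Y]

/-- The adjacency indicator of the bipartite graph. -/
def adj (R : X → Y → Prop) [∀ x y, Decidable (R x y)] (x : X) (y : Y) : ℚ :=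
  if R x y then 1 else 0

/-- The sign function of a separation: `1` on `C \ D`, `-1` on `D \ C`, `0` elsewhere. -/
def sgn {V : Type*} [DecidableEq V] (C D : Finset V) (v : V) : ℚ :=
  (if v ∈ C then 1 else 0) - (if v ∈ D then 1 else 0)

section

variable (R : X → Y → Prop) [∀ x y, Decidable (R x y)]

omit [Fintype X] [Fintype Y] [DecidableEq X] [DecidableEq Y] in
lemma adj_nonneg (x : X) (y : Y) : 0 ≤ adj R x y := by
  unfold adj; split_ifs <;> norm_num

lemma abs_sgn_le {V : Type*} [DecidableEq V] (C D : Finset V) (v : V) : |sgn C D v| ≤ 1 := by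
  unfold sgn; split_ifs <;> norm_num

omit [Fintype X] [DecidableEq X] in
lemma nY_eq_sum (x : X) (C : Finset Y) :
    (nY R x C : ℚ) = ∑ y, adj R x y * (if y ∈ C then 1 else 0) := by
  simp only [nY, adj, Finset.card_filter, Nat.cast_sum, mul_ite, mul_one, mul_zero,
    Finset.sum_ite_mem, Finset.univ_inter]
  simp

omit [Fintype X] [DecidableEq X] in
lemma nY_sub_nY (x : X) (C D : Finset Y) :
    (nY R x C : ℚ) - nY R x D = ∑ y, adj R x y * sgn C D y := by
  simp only [nY_eq_sum, sgn, mul_sub, Finset.sum_sub_distrib]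

omit [Fintype X] [DecidableEq X] in
lemma nY_add_nY (x : X) {C D : Finset Y} (h : C ∪ D = univ) :
    (nY R x C : ℚ) + nY R x D = ∑ y, adj R x y + nY R x (C ∩ D) := by
  simp only [nY_eq_sum, ← Finset.sum_add_distrib]
  refine Finset.sum_congr rfl fun y _ => ?_
  have hy : y ∈ C ∪ D := h ▸ mem_univ y
  rw [mem_union] at hy
  by_cases hC : y ∈ C <;> by_cases hD : y ∈ D
  · simp [hC, hD]
  · simp [hC, hD]
  · simp [hC, hD]
  · tauto

omit [DecidableEq X] in
lemma two_mul_ordY {C D : Finset Y} (h : C ∪ D = univ) :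
    2 * ordY R C D = ∑ x, (∑ y, adj R x y - |∑ y, adj R x y * sgn C D y|) := by
  rw [ordY, Finset.mul_sum]
  refine Finset.sum_congr rfl fun x _ => ?_
  rw [← nY_sub_nY, min_def, abs_eq_max_neg, max_def]
  have := nY_add_nY R x h
  split_ifs <;> linarith

omit [DecidableEq Y] in
lemma two_mul_ordX {A B : Finset X} (h : A ∪ B = univ) :
    2 * ordX R A B = ∑ y, (∑ x, adj R x y - |∑ x, adj R x y * sgn A B x|) :=
  two_mul_ordY (fun y x => R x y) h

omit [Fintype Y] [DecidableEq X] in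
lemma ordY_comm (C D : Finset Y) : ordY R C D = ordY R D C := by
  simp only [ordY, min_comm, inter_comm]

omit [Fintype X] [DecidableEq X] in
lemma abs_sum_adj_mul_sgn_le (x : X) (C D : Finset Y) :
    |∑ y, adj R x y * sgn C D y| ≤ ∑ y, adj R x y := by
  refine (abs_sum_le_sum_abs _ _).trans (Finset.sum_le_sum fun y _ => ?_)
  rw [abs_mul, abs_of_nonneg (adj_nonneg R x y)]
  exact mul_le_of_le_one_right (adj_nonneg R x y) (abs_sgn_le C D y)

omit [Fintype Y] [DecidableEq Y] in
lemma shiftL_union (C D : Finset Y) : shiftL1 R C D ∪ shiftL2 R C D = univ := by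
  ext x
  simpa [shiftL1, shiftL2] using le_total _ _

/-- Shifting a separation does not increase its order. -/
lemma ordX_shiftL_le {C D : Finset Y} (h : C ∪ D = univ) :
    ordX R (shiftL1 R C D) (shiftL2 R C D) ≤ ordY R C D := by
  have hX := two_mul_ordX R (shiftL_union R C D)
  have hY := two_mul_ordY R h
  rw [Finset.sum_sub_distrib] at hX hY
  rw [Finset.sum_comm] at hX
  set t := sgn (shiftL1 R C D) (shiftL2 R C D) with ht
  have habs : ∀ x, |∑ y, adj R x y * sgn C D y| = ∑ y, adj R x y * sgn C D y * t x := by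
    intro x
    rw [← Finset.sum_mul, ← nY_sub_nY]
    simp only [ht, sgn, shiftL1, shiftL2, mem_filter, mem_univ, true_and]
    rcases lt_trichotomy (nY R x C) (nY R x D) with hlt | heq | hlt
    · have hq : (nY R x C : ℚ) < nY R x D := by exact_mod_cast hlt
      rw [abs_of_neg (by linarith), if_neg (by omega), if_pos hlt.le]
      ring
    · simp [heq]
    · have hq : (nY R x D : ℚ) < nY R x C := by exact_mod_cast hlt
      rw [abs_of_pos (by linarith), if_pos hlt.le, if_neg (by omega)]
      ring
  have hle : ∑ x, |∑ y, adj R x y * sgn C D y| ≤ ∑ y, |∑ x, adj R x y * t x| := by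
    simp only [habs]
    rw [Finset.sum_comm]
    refine Finset.sum_le_sum fun y _ => ?_
    calc ∑ x, adj R x y * sgn C D y * t x
        = sgn C D y * ∑ x, adj R x y * t x := by
          rw [Finset.mul_sum]
          exact Finset.sum_congr rfl fun x _ => by ring
      _ ≤ |sgn C D y| * |∑ x, adj R x y * t x| := by
          rw [← abs_mul]
          exact le_abs_self _
      _ ≤ |∑ x, adj R x y * t x| :=
          mul_le_of_le_one_left (abs_nonneg _) (abs_sgn_le C D y)
  linarith

omit [DecidableEq Y] in
/-- Adding `U` to one side of a separation of `X` increases twice its order by at most the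
number of edges at `U`. -/
lemma two_mul_ordX_union_le {A B : Finset X} (h : A ∪ B = univ) (U : Finset X) :
    2 * ordX R (A ∪ U) B ≤ 2 * ordX R A B + ∑ x ∈ U, ∑ y, adj R x y := by
  have hU : A ∪ U ∪ B = univ := by
    rw [union_right_comm, h]
    exact union_eq_left.2 (subset_univ U)
  rw [two_mul_ordX R h, two_mul_ordX R hU, Finset.sum_comm (s := U), ← Finset.sum_add_distrib]
  refine Finset.sum_le_sum fun y _ => ?_
  have hdiff : |∑ x, adj R x y * sgn A B x - ∑ x, adj R x y * sgn (A ∪ U) B x|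
      ≤ ∑ x ∈ U, adj R x y := by
    rw [← Finset.sum_sub_distrib]
    refine (abs_sum_le_sum_abs _ _).trans ?_
    rw [← Finset.univ_inter U, ← Finset.sum_ite_mem]
    refine Finset.sum_le_sum fun x _ => ?_
    rw [← mul_sub, abs_mul, abs_of_nonneg (adj_nonneg R x y)]
    have := adj_nonneg R x y
    by_cases hA : x ∈ A <;> by_cases hx : x ∈ U <;> by_cases hB : x ∈ B <;>
      simp [sgn, hA, hx, hB, this]
  have := abs_sub_abs_le_abs_sub (∑ x, adj R x y * sgn A B x)
    (∑ x, adj R x y * sgn (A ∪ U) B x)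
  linarith

omit [DecidableEq X] in
lemma sum_adj_mul_sgn_neg {C D : Finset Y} {x : X} (hx : x ∉ shiftL1 R C D) :
    ∑ y, adj R x y * sgn C D y < 0 := by
  rw [← nY_sub_nY]
  simp only [shiftL1, mem_filter, mem_univ, true_and, not_le] at hx
  have hq : (nY R x C : ℚ) < nY R x D := by exact_mod_cast hx
  linarith

omit [DecidableEq X] in
/-- If the left-hand sides of three separations of `Y` cover `Y`, then the number of edges at
the vertices not covered by the left-hand sides of their shifts is at most twice the sum of
their orders. -/
lemma sum_adj_le_of_cover {C₁ D₁ C₂ D₂ C₃ D₃ : Finset Y} (h₁ : C₁ ∪ D₁ = univ)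
    (h₂ : C₂ ∪ D₂ = univ) (h₃ : C₃ ∪ D₃ = univ) (hC : C₁ ∪ C₂ ∪ C₃ = univ) {U : Finset X}
    (hU : ∀ x ∈ U, x ∉ shiftL1 R C₁ D₁ ∧ x ∉ shiftL1 R C₂ D₂ ∧ x ∉ shiftL1 R C₃ D₃) :
    ∑ x ∈ U, ∑ y, adj R x y ≤ 2 * ordY R C₁ D₁ + 2 * ordY R C₂ D₂ + 2 * ordY R C₃ D₃ := by
  rw [two_mul_ordY R h₁, two_mul_ordY R h₂, two_mul_ordY R h₃, ← Finset.sum_add_distrib,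
    ← Finset.sum_add_distrib]
  have hpt : ∀ x ∈ U, ∑ y, adj R x y ≤
      (∑ y, adj R x y - |∑ y, adj R x y * sgn C₁ D₁ y|)
      + (∑ y, adj R x y - |∑ y, adj R x y * sgn C₂ D₂ y|)
      + (∑ y, adj R x y - |∑ y, adj R x y * sgn C₃ D₃ y|) := by
    intro x hx
    obtain ⟨hx₁, hx₂, hx₃⟩ := hU x hx
    rw [abs_of_neg (sum_adj_mul_sgn_neg R hx₁), abs_of_neg (sum_adj_mul_sgn_neg R hx₂),
      abs_of_neg (sum_adj_mul_sgn_neg R hx₃)]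
    simp only [sub_neg_eq_add, ← Finset.sum_add_distrib]
    refine Finset.sum_le_sum fun y _ => ?_
    have hsum : -2 ≤ sgn C₁ D₁ y + sgn C₂ D₂ y + sgn C₃ D₃ y := by
      have hy : y ∈ C₁ ∪ C₂ ∪ C₃ := hC ▸ mem_univ y
      simp only [mem_union] at hy
      unfold sgn
      split_ifs <;> first | (norm_num; done) | tauto
    nlinarith [adj_nonneg R x y]
  refine (Finset.sum_le_sum hpt).trans
    (Finset.sum_le_sum_of_subset_of_nonneg (subset_univ U) fun x _ _ => ?_)
  have h₁' := abs_sum_adj_mul_sgn_le R x C₁ D₁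
  have h₂' := abs_sum_adj_mul_sgn_le R x C₂ D₂
  have h₃' := abs_sum_adj_mul_sgn_le R x C₃ D₃
  linarith

end

/-- If `τ` is a tangle of `S_{4k}(X)`, then `^▷τ ∩ S_k(Y)` is a tangle of `S_k(Y)`. -/
theorem tangle_shift (R : X → Y → Prop) [∀ x y, Decidable (R x y)] (k : ℚ) (hk : 0 < k)
    (hdegX : ∀ x : X, ∃ y : Y, R x y) (hdegY : ∀ y : Y, ∃ x : X, R x y)
    (hE : 8 * k ≤ (Fintype.card (Edge R) : ℚ))
    (τ : Set (Finset X × Finset X)) (hτ : IsTangle (ordX R) (4 * k) τ) :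
    IsTangle (ordY R) k (pullY R τ ∩ Sk (ordY R) k) := by
  obtain ⟨_, hor, hcov⟩ := hτ
  refine ⟨fun p hp => hp.2, fun C D hCD hlt => ?_, ?_⟩
  · have hord : ordX R (shiftL1 R C D) (shiftL2 R C D) < 4 * k := by
      linarith [ordX_shiftL_le R hCD]
    have hDC : D ∪ C = univ := union_comm C D ▸ hCD
    have hlt' : ordY R D C < k := ordY_comm R C D ▸ hlt
    have hiff := hor _ _ (shiftL_union R C D) hord
    constructor
    · rintro ⟨⟨_, h⟩, _⟩ ⟨⟨_, h'⟩, _⟩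
      exact hiff.1 h h'
    · intro h
      exact ⟨⟨hCD, hiff.2 fun h' => h ⟨⟨hDC, h'⟩, hDC, hlt'⟩⟩, hCD, hlt⟩
  · rintro ⟨C₁, D₁⟩ ⟨⟨-, h₁⟩, hu₁, ho₁⟩ ⟨C₂, D₂⟩ ⟨⟨-, h₂⟩, hu₂, ho₂⟩ ⟨C₃, D₃⟩
      ⟨⟨-, h₃⟩, hu₃, ho₃⟩ hC
    dsimp only at *
    set A₁ := shiftL1 R C₁ D₁
    set B₁ := shiftL2 R C₁ D₁
    set A₂ := shiftL1 R C₂ D₂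
    set A₃ := shiftL1 R C₃ D₃
    set U := (A₁ ∪ A₂ ∪ A₃)ᶜ with hUdef
    have hAB : A₁ ∪ B₁ = univ := shiftL_union R C₁ D₁
    have hvol := sum_adj_le_of_cover R hu₁ hu₂ hu₃ hC (U := U) fun x hx => by
      simpa only [hUdef, mem_compl, mem_union, not_or, and_assoc] using hx
    have hord : ordX R (A₁ ∪ U) B₁ < 4 * k := by
      have hadd := two_mul_ordX_union_le R hAB U
      have hshift := ordX_shiftL_le R hu₁
      linarith
    have hABU : A₁ ∪ U ∪ B₁ = univ := by
      rw [union_right_comm, hAB]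
      exact union_eq_left.2 (subset_univ U)
    have hmem : (A₁ ∪ U, B₁) ∈ τ :=
      (hor _ _ hABU hord).2 fun h => hcov _ h₁ _ h _ h (by simp [hAB])
    refine hcov _ hmem _ h₂ _ h₃ ?_
    dsimp only
    rw [union_right_comm A₁ U A₂, union_right_comm _ U A₃]
    exact union_compl _

end BipSep
end

section
/- The order function on the separations of E is submodular: for all separations (C₁,D₁) and (C₂,D₂) of E one has |C₁ ∪ C₂, D₁ ∩ D₂|_E + |C₁ ∩ C₂, D₁ ∪ D₂|_E ≤ |C₁,D₁|_E + |C₂,D₂|_E. -/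
open Finset

namespace BipSep

variable {X Y : Type*} [Fintype X] [Fintype Y] [DecidableEq X] [DecidableEq Y]

/-- Submodularity of the contribution of a single vertex, whose incident edges are those
satisfying `p`, to the order of a separation. -/
theorem local_order_submodular {V : Type*} [Fintype V] [DecidableEq V] (p : V → Prop)
    [DecidablePred p] {C₁ D₁ C₂ D₂ : Finset V} (h₁ : C₁ ∪ D₁ = univ) (h₂ : C₂ ∪ D₂ = univ) :
    ((min ((C₁ ∪ C₂).filter p).card ((D₁ ∩ D₂).filter p).card : ℚ) -
        (((C₁ ∪ C₂) ∩ (D₁ ∩ D₂)).filter p).card / 2) +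
      ((min ((C₁ ∩ C₂).filter p).card ((D₁ ∪ D₂).filter p).card : ℚ) -
        (((C₁ ∩ C₂) ∩ (D₁ ∪ D₂)).filter p).card / 2) ≤
      ((min (C₁.filter p).card (D₁.filter p).card : ℚ) - ((C₁ ∩ D₁).filter p).card / 2) +
      ((min (C₂.filter p).card (D₂.filter p).card : ℚ) - ((C₂ ∩ D₂).filter p).card / 2) := by
  have modular (A B : Finset V) : (((A ∪ B).filter p).card : ℚ) + ((A ∩ B).filter p).card =
      (A.filter p).card + (B.filter p).card := by
    rw [filter_union, filter_inter_distrib]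
    exact_mod_cast card_union_add_card_inter (A.filter p) (B.filter p)
  have mono {A B : Finset V} (h : A ⊆ B) : ((A.filter p).card : ℚ) ≤ (B.filter p).card := by
    exact_mod_cast card_le_card (filter_subset_filter p h)
  have hsup : (C₁ ∪ C₂) ∪ (D₁ ∩ D₂) = univ := by
    ext v
    have := Finset.ext_iff.1 h₁ v
    have := Finset.ext_iff.1 h₂ v
    simp only [mem_union, mem_inter, mem_univ, iff_true] at *
    tauto
  have hinf : (C₁ ∩ C₂) ∪ (D₁ ∪ D₂) = univ := by
    ext v
    have := Finset.ext_iff.1 h₁ v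
    have := Finset.ext_iff.1 h₂ v
    simp only [mem_union, mem_inter, mem_univ, iff_true] at *
    tauto
  have m₁ := modular C₁ D₁
  have m₂ := modular C₂ D₂
  have ms := modular (C₁ ∪ C₂) (D₁ ∩ D₂)
  have mi := modular (C₁ ∩ C₂) (D₁ ∪ D₂)
  rw [h₁] at m₁
  rw [h₂] at m₂
  rw [hsup] at ms
  rw [hinf] at mi
  have mC := modular C₁ C₂
  have mD := modular D₁ D₂
  have hC₁ := mono (inter_subset_left : C₁ ∩ C₂ ⊆ C₁)
  have hC₂ := mono (inter_subset_right : C₁ ∩ C₂ ⊆ C₂)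
  have hD₁ := mono (inter_subset_left : D₁ ∩ D₂ ⊆ D₁)
  have hD₂ := mono (inter_subset_right : D₁ ∩ D₂ ⊆ D₂)
  rcases min_cases ((C₁.filter p).card : ℚ) (D₁.filter p).card with ⟨e₁, _⟩ | ⟨e₁, _⟩ <;>
  rcases min_cases ((C₂.filter p).card : ℚ) (D₂.filter p).card with ⟨e₂, _⟩ | ⟨e₂, _⟩ <;>
  rw [e₁, e₂] <;>
  linarith [min_le_left (((C₁ ∪ C₂).filter p).card : ℚ) ((D₁ ∩ D₂).filter p).card,
    min_le_right (((C₁ ∪ C₂).filter p).card : ℚ) ((D₁ ∩ D₂).filter p).card,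
    min_le_left (((C₁ ∩ C₂).filter p).card : ℚ) ((D₁ ∪ D₂).filter p).card,
    min_le_right (((C₁ ∩ C₂).filter p).card : ℚ) ((D₁ ∪ D₂).filter p).card]

/-- The order function `|·|_E` on the separations of `E` is submodular. -/
theorem ordE_submodular (R : X → Y → Prop) [∀ x y, Decidable (R x y)]
    (C₁ D₁ C₂ D₂ : Finset (Edge R)) (h₁ : C₁ ∪ D₁ = univ) (h₂ : C₂ ∪ D₂ = univ) :
    ordE R (C₁ ∪ C₂) (D₁ ∩ D₂) + ordE R (C₁ ∩ C₂) (D₁ ∪ D₂) ≤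
      ordE R C₁ D₁ + ordE R C₂ D₂ := by
  have hX := sum_le_sum fun (x : X) (_ : x ∈ univ) =>
    local_order_submodular (fun e : Edge R => e.1.1 = x) h₁ h₂
  have hY := sum_le_sum fun (y : Y) (_ : y ∈ univ) =>
    local_order_submodular (fun e : Edge R => e.1.2 = y) h₁ h₂
  rw [sum_add_distrib, sum_add_distrib] at hX hY
  simp only [ordE, eX, eY]
  linarith

end BipSep
end

section
/- For every separation (A,B) of X one has |A,B|_X ≤ |(A,B)^E|_E and |(A,B)^E|_E ≤ 2·|A,B|_X. -/
open Finset

namespace BipSep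

variable {X Y : Type*} [Fintype X] [Fintype Y] [DecidableEq X] [DecidableEq Y]

theorem edgesOf_inter (R : X → Y → Prop) [∀ x y, Decidable (R x y)] (A B : Finset X) :
    edgesOf R A ∩ edgesOf R B = edgesOf R (A ∩ B) := by
  ext e
  simp [edgesOf]

theorem eY_edgesOf (R : X → Y → Prop) [∀ x y, Decidable (R x y)] (y : Y) (A : Finset X) :
    eY R y (edgesOf R A) = nX R y A := by
  unfold eY nX
  refine card_bij (fun e _ => e.1.1) ?_ ?_ ?_
  · rintro ⟨⟨x, z⟩, hR⟩ he
    simp only [edgesOf, mem_filter, mem_univ, true_and] at he ⊢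
    obtain ⟨hx, rfl⟩ := he
    exact ⟨hx, hR⟩
  · rintro ⟨⟨x, z⟩, hR⟩ he ⟨⟨x', z'⟩, hR'⟩ he' hxx
    simp only [edgesOf, mem_filter, mem_univ, true_and] at he he' hxx
    simp [hxx, he.2, he'.2]
  · intro x hx
    rw [mem_filter] at hx
    exact ⟨⟨(x, y), hx.2⟩, by simp [edgesOf, hx.1], rfl⟩

omit [DecidableEq Y] in
theorem eX_edgesOf (R : X → Y → Prop) [∀ x y, Decidable (R x y)] (x : X) (A : Finset X) :
    eX R x (edgesOf R A) = if x ∈ A then eX R x univ else 0 := by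
  unfold eX edgesOf
  rw [filter_filter]
  split_ifs with hx
  · congr 1
    refine filter_congr fun e _ => ⟨fun h => h.2, fun h => ⟨h ▸ hx, h⟩⟩
  · rw [card_eq_zero, filter_eq_empty_iff]
    rintro e - ⟨he, rfl⟩
    exact hx he

/-- Double counting of the edges in `C` by their endpoints. -/
theorem sum_eX_eq_sum_eY (R : X → Y → Prop) [∀ x y, Decidable (R x y)] (C : Finset (Edge R)) :
    ∑ x, eX R x C = ∑ y, eY R y C :=
  (card_eq_sum_card_fiberwise fun _ _ => mem_coe.2 (mem_univ _)).symm.trans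
    (card_eq_sum_card_fiberwise fun _ _ => mem_coe.2 (mem_univ _))

theorem ordE_edgesOf (R : X → Y → Prop) [∀ x y, Decidable (R x y)] (A B : Finset X) :
    ordE R (edgesOf R A) (edgesOf R B) = (∑ y, (nX R y (A ∩ B) : ℚ)) / 2 + ordX R A B := by
  have hX (x : X) : (min (eX R x (edgesOf R A)) (eX R x (edgesOf R B)) : ℚ) -
      (eX R x (edgesOf R (A ∩ B)) : ℚ) / 2 = (eX R x (edgesOf R (A ∩ B)) : ℚ) / 2 := by
    simp only [eX_edgesOf, mem_inter]
    by_cases hA : x ∈ A <;> by_cases hB : x ∈ B <;> simp [hA, hB, sub_half]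
  have hsum : ∑ x, (eX R x (edgesOf R (A ∩ B)) : ℚ) = ∑ y, (nX R y (A ∩ B) : ℚ) := by
    simpa only [eY_edgesOf, Nat.cast_sum] using
      congrArg (Nat.cast : ℕ → ℚ) (sum_eX_eq_sum_eY R (edgesOf R (A ∩ B)))
  simp only [ordE, ordX, edgesOf_inter, hX, eY_edgesOf]
  rw [← sum_div, hsum]

omit [Fintype X] [DecidableEq Y] in
theorem sum_nX_inter_le_ordX (R : X → Y → Prop) [∀ x y, Decidable (R x y)] (A B : Finset X) :
    (∑ y, (nX R y (A ∩ B) : ℚ)) / 2 ≤ ordX R A B := by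
  rw [ordX, sum_div]
  refine sum_le_sum fun y _ => ?_
  have : (nX R y (A ∩ B) : ℚ) ≤ min (nX R y A : ℚ) (nX R y B) :=
    le_min (mod_cast nX_mono R y inter_subset_left) (mod_cast nX_mono R y inter_subset_right)
  linarith

/-- `|A,B|_X ≤ |(A,B)^E|_E ≤ 2|A,B|_X` for every separation `(A,B)` of `X`. -/
theorem ordX_le_ordE_le (R : X → Y → Prop) [∀ x y, Decidable (R x y)]
    (A B : Finset X) (h : A ∪ B = univ) :
    ordX R A B ≤ ordE R (edgesOf R A) (edgesOf R B) ∧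
      ordE R (edgesOf R A) (edgesOf R B) ≤ 2 * ordX R A B := by
  have hnonneg : 0 ≤ (∑ y, (nX R y (A ∩ B) : ℚ)) / 2 := by positivity
  have hle := sum_nX_inter_le_ordX R A B
  rw [ordE_edgesOf]
  constructor <;> linarith

end BipSep
end

section
/- For every separation (C,D) of E one has |C,D|_E ≥ |C^◀_D, D^◀_C|_X. -/
open Finset

namespace BipSep

variable {X Y : Type*} [Fintype X] [Fintype Y] [DecidableEq X] [DecidableEq Y]

/-- The balance `[a ∈ C] - [a ∈ D] ∈ {-1, 0, 1}` of a point `a` with respect to `(C, D)`. -/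
def balance {α : Type*} [DecidableEq α] (C D : Finset α) (a : α) : ℚ :=
  (if a ∈ C then 1 else 0) - (if a ∈ D then 1 else 0)

lemma sum_balance {α : Type*} [Fintype α] [DecidableEq α] (C D : Finset α)
    (P : α → Prop) [DecidablePred P] :
    ∑ a with P a, balance C D a = ((C.filter P).card : ℚ) - ((D.filter P).card : ℚ) := by
  simp only [balance, sum_sub_distrib, sum_boole, filter_filter]
  congr 3 <;> · ext a; simp [and_comm]

lemma abs_balance_le_one {α : Type*} [DecidableEq α] (C D : Finset α) (a : α) :
    |balance C D a| ≤ 1 := by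
  unfold balance
  split_ifs <;> norm_num

/-- The contribution of a vertex to the order of a separation depends only on its degree and
on the total balance of its neighbourhood. -/
lemma min_card_sub_half_card_inter {α : Type*} [Fintype α] [DecidableEq α] (C D : Finset α)
    (h : C ∪ D = univ) (P : α → Prop) [DecidablePred P] :
    min ((C.filter P).card : ℚ) ((D.filter P).card : ℚ) - (((C ∩ D).filter P).card : ℚ) / 2 =
      ((∑ a with P a, (1 : ℚ)) - |∑ a with P a, balance C D a|) / 2 := by
  have hcard := card_union_add_card_inter (C.filter P) (D.filter P)
  rw [← filter_union, h, ← filter_inter_distrib] at hcard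
  have hcard' : ((univ.filter P).card : ℚ) + (((C ∩ D).filter P).card : ℚ) =
      ((C.filter P).card : ℚ) + ((D.filter P).card : ℚ) := by exact_mod_cast hcard
  have hadd := min_add_max ((C.filter P).card : ℚ) ((D.filter P).card : ℚ)
  have hsub := max_sub_min_eq_abs' ((C.filter P).card : ℚ) ((D.filter P).card : ℚ)
  rw [sum_balance, sum_const, nsmul_eq_mul, mul_one]
  linarith

/-- Summing over the neighbours of `y` is summing over the edges at `y`. -/
lemma sum_neighbours_eq_sum_edges (R : X → Y → Prop) [∀ x y, Decidable (R x y)] (y : Y)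
    (f : X → ℚ) :
    ∑ x with R x y, f x = ∑ e : Edge R with e.1.2 = y, f e.1.1 := by
  refine (sum_bij (fun e _ => e.1.1) ?_ ?_ ?_ ?_).symm
  · rintro ⟨⟨x, y'⟩, hxy⟩ he
    obtain rfl : y' = y := (mem_filter.1 he).2
    exact mem_filter.2 ⟨mem_univ x, hxy⟩
  · rintro ⟨⟨x, y₁⟩, h₁⟩ he₁ ⟨⟨x', y₂⟩, h₂⟩ he₂ hx
    simp_all
  · intro x hx
    exact ⟨⟨(x, y), (mem_filter.1 hx).2⟩, by simp, rfl⟩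
  · intros
    rfl

lemma balance_bshift (R : X → Y → Prop) [∀ x y, Decidable (R x y)]
    (C D : Finset (Edge R)) (x : X) :
    balance (bshift1 R C D) (bshift2 R C D) x =
      SignType.sign (∑ e : Edge R with e.1.1 = x, balance C D e) := by
  have hsum : ∑ e : Edge R with e.1.1 = x, balance C D e = (eX R x C : ℚ) - eX R x D :=
    sum_balance C D _
  rw [hsum]
  rcases lt_trichotomy (eX R x C) (eX R x D) with hlt | heq | hlt
  · have : (eX R x C : ℚ) - eX R x D < 0 := sub_neg.2 (by exact_mod_cast hlt)
    simp [balance, bshift1, bshift2, sign_neg this, hlt.le, hlt]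
  · simp [balance, bshift1, bshift2, heq]
  · have : 0 < (eX R x C : ℚ) - eX R x D := sub_pos.2 (by exact_mod_cast hlt)
    simp [balance, bshift1, bshift2, sign_pos this, hlt.le, hlt]

/-- Replacing weights in `[-1, 1]` by the sign of their sum costs at most the defect of that
sum from its maximal absolute value. -/
lemma sum_abs_sub_sign_sum_le {ι : Type*} (s : Finset ι) (w : ι → ℚ) (hw : ∀ i ∈ s, |w i| ≤ 1) :
    ∑ i ∈ s, |w i - (SignType.sign (∑ j ∈ s, w j) : ℚ)| ≤ ∑ _i ∈ s, (1 : ℚ) - |∑ i ∈ s, w i| := by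
  rcases lt_trichotomy (∑ j ∈ s, w j) 0 with hlt | heq | hlt
  · rw [sign_neg hlt, abs_of_neg hlt, sub_neg_eq_add, ← sum_add_distrib]
    refine sum_le_sum fun i hi => ?_
    have := abs_le.1 (hw i hi)
    rw [SignType.coe_neg_one, abs_of_nonneg (by linarith)]
    linarith
  · simpa [heq] using sum_le_sum hw
  · rw [sign_pos hlt, abs_of_pos hlt, ← sum_sub_distrib]
    refine sum_le_sum fun i hi => ?_
    have := abs_le.1 (hw i hi)
    rw [SignType.coe_one, abs_of_nonpos (by linarith)]
    linarith

/-- `|C,D|_E ≥ |C^◀_D, D^◀_C|_X` for every separation `(C,D)` of `E`. -/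
theorem bshift_order_le (R : X → Y → Prop) [∀ x y, Decidable (R x y)]
    (C D : Finset (Edge R)) (h : C ∪ D = univ) :
    ordX R (bshift1 R C D) (bshift2 R C D) ≤ ordE R C D := by
  have hshift : bshift1 R C D ∪ bshift2 R C D = univ := by
    ext x
    simpa [bshift1, bshift2] using le_total (eX R x D) (eX R x C)
  set w := balance C D
  set s := balance (bshift1 R C D) (bshift2 R C D) with hs
  have hX : ordX R (bshift1 R C D) (bshift2 R C D) =
      ∑ y : Y, ((∑ e : Edge R with e.1.2 = y, (1 : ℚ)) -
        |∑ e : Edge R with e.1.2 = y, s e.1.1|) / 2 := by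
    refine sum_congr rfl fun y _ => ?_
    rw [← sum_neighbours_eq_sum_edges R y s, ← sum_neighbours_eq_sum_edges R y fun _ => 1]
    exact min_card_sub_half_card_inter _ _ hshift _
  have hE : ordE R C D =
      ∑ x : X, ((∑ e : Edge R with e.1.1 = x, (1 : ℚ)) - |∑ e : Edge R with e.1.1 = x, w e|) / 2 +
      ∑ y : Y, ((∑ e : Edge R with e.1.2 = y, (1 : ℚ)) -
        |∑ e : Edge R with e.1.2 = y, w e|) / 2 :=
    congrArg₂ (· + ·) (sum_congr rfl fun _ _ => min_card_sub_half_card_inter C D h _)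
      (sum_congr rfl fun _ _ => min_card_sub_half_card_inter C D h _)
  have hy : ∑ y : Y, (|∑ e : Edge R with e.1.2 = y, w e| -
      |∑ e : Edge R with e.1.2 = y, s e.1.1|) ≤ ∑ e : Edge R, |w e - s e.1.1| := by
    rw [← sum_fiberwise univ (fun e : Edge R => e.1.2)]
    refine sum_le_sum fun y _ => (abs_sub_abs_le_abs_sub _ _).trans ?_
    rw [← sum_sub_distrib]
    exact abs_sum_le_sum_abs _ _
  have hx : ∑ e : Edge R, |w e - s e.1.1| ≤
      ∑ x : X, ((∑ e : Edge R with e.1.1 = x, (1 : ℚ)) -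
        |∑ e : Edge R with e.1.1 = x, w e|) := by
    rw [← sum_fiberwise univ (fun e : Edge R => e.1.1)]
    refine sum_le_sum fun x _ => le_trans (le_of_eq (sum_congr rfl fun e he => ?_))
      (sum_abs_sub_sign_sum_le _ w fun e _ => abs_balance_le_one C D e)
    rw [(mem_filter.1 he).2, hs, balance_bshift]
  rw [hX, hE]
  simp only [← sum_div, sum_sub_distrib] at hx hy ⊢
  linarith

end BipSep
end

section
/- Let (C,D) be a separation of E and let e ∈ E be an edge whose endpoint in X lies in C^◀_D ∖ D^◀_C. Then |C ∪ {e}, D ∖ {e}|_E ≤ |C,D|_E and (C ∪ {e}, D ∖ {e})^◀ = (C,D)^◀. -/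
open Finset

namespace BipSep

variable {X Y : Type*} [Fintype X] [Fintype Y] [DecidableEq X] [DecidableEq Y]

/-- The number of members of `insert e C` in the fibre of `f` over `v`. -/
theorem card_fiber_insert {α V : Type*} [DecidableEq α] [DecidableEq V] (f : α → V)
    (C : Finset α) (e : α) (v : V) :
    ((insert e C).filter fun a => f a = v).card =
      (C.filter fun a => f a = v).card + if v = f e ∧ e ∉ C then 1 else 0 := by
  rw [filter_insert]
  by_cases hv : f e = v <;> by_cases hC : e ∈ C <;> simp [hv, hC, eq_comm (a := v)]

/-- The number of members of `D` in the fibre of `f` over `v`, in terms of `D.erase e`. -/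
theorem card_fiber_erase {α V : Type*} [DecidableEq α] [DecidableEq V] (f : α → V)
    (D : Finset α) (e : α) (v : V) :
    (D.filter fun a => f a = v).card =
      ((D.erase e).filter fun a => f a = v).card + if v = f e ∧ e ∈ D then 1 else 0 := by
  by_cases hD : e ∈ D
  · have := card_fiber_insert f (D.erase e) e v
    rw [insert_erase hD] at this
    simpa [hD] using this
  · simp [hD]

/-- The amount by which the minimum of the two degrees, corrected by half the degree in the
intersection, can change at an endpoint of `e` when `e` is moved from `D` to `C`. -/
def moveCost {α : Type*} [DecidableEq α] (C D : Finset α) (e : α) : ℚ :=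
  if e ∈ C then if e ∈ D then 1 / 2 else 0 else 1

/-- The effect of moving `e` from `D` to `C` on a term of the order: `c` is the degree in `C`,
`d` the degree in `D.erase e`, and `i` the degree in `(C ∩ D).erase e`. -/
theorem min_sub_half_move {α : Type*} [DecidableEq α] (C D : Finset α) (e : α)
    (h : e ∈ C ∪ D) (c d i : ℕ) :
    min ((c + if e ∈ C then 0 else 1 : ℕ) : ℚ) d - (i : ℚ) / 2 ≤
      min (c : ℚ) (d + if e ∈ D then 1 else 0 : ℕ) -
        ((i + if e ∈ C ∩ D then 1 else 0 : ℕ) : ℚ) / 2 + moveCost C D e ∧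
    ((d + if e ∈ D then 1 else 0) + 1 ≤ c →
      min ((c + if e ∈ C then 0 else 1 : ℕ) : ℚ) d - (i : ℚ) / 2 ≤
        min (c : ℚ) (d + if e ∈ D then 1 else 0 : ℕ) -
          ((i + if e ∈ C ∩ D then 1 else 0 : ℕ) : ℚ) / 2 - moveCost C D e) := by
  rw [mem_union] at h
  by_cases heC : e ∈ C <;> by_cases heD : e ∈ D <;>
    simp only [heC, heD, or_self, moveCost, mem_inter, and_true, and_false, if_true,
      if_false, Nat.cast_add, Nat.cast_one, Nat.cast_zero] at h ⊢ <;>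
    refine ⟨?_, fun hlt => ?_⟩ <;> (try qify at hlt) <;> grind

/-- Moving `e` from `D` to `C` changes the contribution of the fibre over `v` to the order only
if `v = f e`; it then increases by at most `moveCost C D e`, and it decreases by that amount if
`C` is larger than `D` on this fibre. -/
theorem fiber_order_move {α V : Type*} [DecidableEq α] [DecidableEq V] (f : α → V)
    (C D : Finset α) (e : α) (h : e ∈ C ∪ D) (v : V) :
    let n : Finset α → ℕ := fun S => (S.filter fun a => f a = v).card
    let t : Finset α → Finset α → ℚ := fun S T => min (n S : ℚ) (n T) - (n (S ∩ T) : ℚ) / 2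
    t (insert e C) (D.erase e) ≤ t C D + (if v = f e then moveCost C D e else 0) ∧
      ((v = f e → n D < n C) →
        t (insert e C) (D.erase e) ≤ t C D + if v = f e then -moveCost C D e else 0) := by
  intro n t
  have hC : n (insert e C) = _ := card_fiber_insert f C e v
  have hD : n D = _ := card_fiber_erase f D e v
  have hI : n (C ∩ D) = _ := card_fiber_erase f (C ∩ D) e v
  have hI' : insert e C ∩ D.erase e = (C ∩ D).erase e := by
    ext a
    simp only [mem_inter, mem_insert, mem_erase]
    tauto
  change n D = n (D.erase e) + _ at hD
  change n (insert e C) = n C + _ at hC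
  change n (C ∩ D) = n ((C ∩ D).erase e) + _ at hI
  simp only [t, hI', moveCost]
  rw [hC, hD, hI]
  by_cases hv : v = f e
  · simpa [hv, moveCost, sub_eq_add_neg, Nat.succ_le_iff] using
      min_sub_half_move C D e h (n C) (n (D.erase e)) (n ((C ∩ D).erase e))
  · simp [hv]

/-- Moving an edge incident with `C^◀_D ∖ D^◀_C` from `D` to `C` does not increase the
order and does not change the shift. -/
theorem move_over (R : X → Y → Prop) [∀ x y, Decidable (R x y)]
    (C D : Finset (Edge R)) (h : C ∪ D = univ) (e : Edge R)
    (he : e.1.1 ∈ bshift1 R C D \ bshift2 R C D) :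
    ordE R (insert e C) (D.erase e) ≤ ordE R C D ∧
      bshift1 R (insert e C) (D.erase e) = bshift1 R C D ∧
      bshift2 R (insert e C) (D.erase e) = bshift2 R C D := by
  have hmem : e ∈ C ∪ D := h ▸ mem_univ e
  have hlt : eX R e.1.1 D < eX R e.1.1 C := by
    simp only [bshift1, bshift2, mem_sdiff, mem_filter, mem_univ, true_and] at he
    exact not_le.mp he.2
  have hC (x : X) : eX R x (insert e C) = _ := card_fiber_insert (fun a : Edge R => a.1.1) C e x
  have hD (x : X) : eX R x D = _ := card_fiber_erase (fun a : Edge R => a.1.1) D e x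
  change ∀ x, eX R x D = eX R x (D.erase e) + _ at hD
  change ∀ x, eX R x (insert e C) = eX R x C + _ at hC
  refine ⟨?_, ?_, ?_⟩
  · have hX := sum_le_sum fun x (_ : x ∈ univ) =>
      (fiber_order_move (fun a : Edge R => a.1.1) C D e hmem x).2 (by rintro rfl; exact hlt)
    have hY := sum_le_sum fun y (_ : y ∈ univ) =>
      (fiber_order_move (fun a : Edge R => a.1.2) C D e hmem y).1
    simp only [sum_add_distrib, sum_ite_eq', mem_univ, if_true] at hX hY
    unfold ordE eX eY
    linarith
  all_goals
    ext x
    have := hC x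
    have := hD x
    simp only [bshift1, bshift2, mem_filter, mem_univ, true_and]
    grind

end BipSep
end

section
/- For every separation (C,D) of E there exists a separation (C',D') of E with |C',D'|_E ≤ |C,D|_E and (C',D')^◀ = (C,D)^◀ such that every edge whose endpoint in X lies in C^◀_D ∖ D^◀_C belongs to C' ∖ D', and every edge whose endpoint in X lies in D^◀_C ∖ C^◀_D belongs to D' ∖ C'. -/
open Finset

namespace BipSep

variable {X Y : Type*} [Fintype X] [Fintype Y] [DecidableEq X] [DecidableEq Y]

/-- The contribution of `e` to the `C`-side of the separation `(C,D)`: it is `1` if `e` lies in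
`C` only, `1/2` if it lies in both sides, and `0` if it lies in `D` only. -/
def sideWeight {E : Type*} [DecidableEq E] (C D : Finset E) (e : E) : ℚ :=
  (if e ∈ C then 1 else 0) - (if e ∈ C ∩ D then 1 else 0) / 2

theorem sideWeight_nonneg {E : Type*} [DecidableEq E] (C D : Finset E) (e : E) :
    0 ≤ sideWeight C D e := by
  unfold sideWeight
  by_cases hC : e ∈ C <;> by_cases hD : e ∈ D <;> norm_num [hC, hD]

theorem sideWeight_add_sideWeight {E : Type*} [Fintype E] [DecidableEq E] {C D : Finset E}
    (h : C ∪ D = univ) (e : E) : sideWeight C D e + sideWeight D C e = 1 := by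
  have he : e ∈ C ∨ e ∈ D := by simpa using congrArg (e ∈ ·) h
  unfold sideWeight
  by_cases hC : e ∈ C <;> by_cases hD : e ∈ D <;> norm_num [hC, hD]
  tauto

theorem sum_sideWeight {E : Type*} [DecidableEq E] [Fintype E] (p : E → Prop)
    [DecidablePred p] (C D : Finset E) :
    ∑ e with p e, sideWeight C D e
      = ((C.filter p).card : ℚ) - (((C ∩ D).filter p).card : ℚ) / 2 := by
  have key (S : Finset E) :
      ∑ e with p e, (if e ∈ S then (1 : ℚ) else 0) = ((S.filter p).card : ℚ) := by
    rw [← Finset.sum_filter, Finset.filter_filter, Finset.sum_const, nsmul_eq_mul, mul_one]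
    congr 2
    ext e
    simp [and_comm]
  simp only [sideWeight]
  rw [Finset.sum_sub_distrib, ← Finset.sum_div, key, key]

theorem min_card_sub_eq {E : Type*} [DecidableEq E] [Fintype E] (p : E → Prop)
    [DecidablePred p] (C D : Finset E) :
    min ((C.filter p).card : ℚ) ((D.filter p).card : ℚ) - (((C ∩ D).filter p).card : ℚ) / 2
      = min (∑ e with p e, sideWeight C D e) (∑ e with p e, sideWeight D C e) := by
  rw [sum_sideWeight, sum_sideWeight, Finset.inter_comm D C, min_sub_sub_right]

theorem ordE_eq_sum_sideWeight (R : X → Y → Prop) [∀ x y, Decidable (R x y)]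
    (C D : Finset (Edge R)) :
    ordE R C D =
      (∑ x : X, min (∑ e : Edge R with e.1.1 = x, sideWeight C D e)
        (∑ e : Edge R with e.1.1 = x, sideWeight D C e)) +
      ∑ y : Y, min (∑ e : Edge R with e.1.2 = y, sideWeight C D e)
        (∑ e : Edge R with e.1.2 = y, sideWeight D C e) := by
  simp only [ordE, eX, eY, min_card_sub_eq]

/-- If the side weights of `(C',D')` exceed those of `(C,D)` by at most `δ`, and at every
vertex of `X` the order drops by at least the total of `δ`, then the order does not increase. -/
theorem ordE_le_ordE_of_sideWeight_le (R : X → Y → Prop) [∀ x y, Decidable (R x y)]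
    {C D C' D' : Finset (Edge R)} (δ : Edge R → ℚ)
    (hC : ∀ e, sideWeight C' D' e ≤ sideWeight C D e + δ e)
    (hD : ∀ e, sideWeight D' C' e ≤ sideWeight D C e + δ e)
    (hX : ∀ x : X,
      min (∑ e : Edge R with e.1.1 = x, sideWeight C' D' e)
          (∑ e : Edge R with e.1.1 = x, sideWeight D' C' e)
        + ∑ e : Edge R with e.1.1 = x, δ e
      ≤ min (∑ e : Edge R with e.1.1 = x, sideWeight C D e)
          (∑ e : Edge R with e.1.1 = x, sideWeight D C e)) :
    ordE R C' D' ≤ ordE R C D := by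
  rw [ordE_eq_sum_sideWeight, ordE_eq_sum_sideWeight]
  have hY : ∀ y : Y,
      min (∑ e : Edge R with e.1.2 = y, sideWeight C' D' e)
          (∑ e : Edge R with e.1.2 = y, sideWeight D' C' e)
      ≤ min (∑ e : Edge R with e.1.2 = y, sideWeight C D e)
          (∑ e : Edge R with e.1.2 = y, sideWeight D C e)
        + ∑ e : Edge R with e.1.2 = y, δ e := by
    intro y
    rw [← min_add_add_right, ← Finset.sum_add_distrib, ← Finset.sum_add_distrib]
    exact min_le_min (Finset.sum_le_sum fun e _ => hC e) (Finset.sum_le_sum fun e _ => hD e)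
  have sX := Finset.sum_le_sum fun x (_ : x ∈ univ) => hX x
  have sY := Finset.sum_le_sum fun y (_ : y ∈ univ) => hY y
  rw [Finset.sum_add_distrib, Finset.sum_fiberwise] at sX sY
  linarith

/-- The edges of `C`, without those at vertices leaning strictly towards `D`, together with all
edges at vertices of `X` leaning strictly towards `C`. -/
def alignSide (R : X → Y → Prop) [∀ x y, Decidable (R x y)] (C D : Finset (Edge R)) :
    Finset (Edge R) :=
  univ.filter fun e => eX R e.1.1 D < eX R e.1.1 C ∨ eX R e.1.1 D = eX R e.1.1 C ∧ e ∈ C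

section alignSide

variable (R : X → Y → Prop) [∀ x y, Decidable (R x y)] {C D : Finset (Edge R)}

theorem mem_alignSide {e : Edge R} : e ∈ alignSide R C D ↔
    eX R e.1.1 D < eX R e.1.1 C ∨ eX R e.1.1 D = eX R e.1.1 C ∧ e ∈ C := by
  simp [alignSide]

theorem alignSide_union_alignSide (h : C ∪ D = univ) :
    alignSide R C D ∪ alignSide R D C = univ := by
  ext e
  have he : e ∈ C ∨ e ∈ D := by simpa using congrArg (e ∈ ·) h
  simp only [mem_union, mem_alignSide, mem_univ, iff_true]
  grind

theorem eX_alignSide_of_lt {x : X} (hx : eX R x D < eX R x C) :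
    eX R x C ≤ eX R x (alignSide R C D) := by
  refine Finset.card_le_card fun e he => ?_
  obtain ⟨-, rfl⟩ := Finset.mem_filter.1 he
  simp [mem_alignSide, hx]

theorem eX_alignSide_of_gt {x : X} (hx : eX R x C < eX R x D) :
    eX R x (alignSide R C D) = 0 := by
  refine Finset.card_eq_zero.2 (Finset.filter_eq_empty_iff.2 ?_)
  rintro e he rfl
  rw [mem_alignSide] at he
  omega

theorem eX_alignSide_of_eq {x : X} (hx : eX R x D = eX R x C) :
    eX R x (alignSide R C D) = eX R x C := by
  refine congrArg Finset.card (Finset.ext fun e => ?_)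
  simp only [Finset.mem_filter, mem_alignSide]
  constructor
  · rintro ⟨he, rfl⟩
    simpa [hx] using he
  · rintro ⟨he, rfl⟩
    simp [hx, he]

theorem eX_alignSide_le_iff {x : X} :
    eX R x (alignSide R C D) ≤ eX R x (alignSide R D C) ↔ eX R x C ≤ eX R x D := by
  rcases lt_trichotomy (eX R x C) (eX R x D) with hx | hx | hx
  · simp [eX_alignSide_of_gt R hx, hx.le]
  · rw [eX_alignSide_of_eq R hx.symm, eX_alignSide_of_eq R hx]
  · have := eX_alignSide_of_lt R hx
    rw [eX_alignSide_of_gt R hx]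
    omega

theorem sideWeight_alignSide_of_lt {e : Edge R} (he : eX R e.1.1 D < eX R e.1.1 C) :
    sideWeight (alignSide R C D) (alignSide R D C) e = 1 ∧
      sideWeight (alignSide R D C) (alignSide R C D) e = 0 := by
  have h₁ : e ∈ alignSide R C D := (mem_alignSide R).2 (.inl he)
  have h₂ : e ∉ alignSide R D C := by rw [mem_alignSide]; omega
  simp [sideWeight, h₁, h₂]

theorem sideWeight_alignSide_of_eq {e : Edge R} (he : eX R e.1.1 D = eX R e.1.1 C) :
    sideWeight (alignSide R C D) (alignSide R D C) e = sideWeight C D e := by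
  simp [sideWeight, mem_alignSide, he]

theorem sum_sideWeight_le_sum_sideWeight {x : X} (hx : eX R x D ≤ eX R x C) :
    ∑ e : Edge R with e.1.1 = x, sideWeight D C e
      ≤ ∑ e : Edge R with e.1.1 = x, sideWeight C D e := by
  rw [sum_sideWeight, sum_sideWeight, Finset.inter_comm D C]
  exact sub_le_sub_right (Nat.cast_le.2 hx) _

theorem ordE_alignSide_le (h : C ∪ D = univ) :
    ordE R (alignSide R C D) (alignSide R D C) ≤ ordE R C D := by
  have hw := sideWeight_add_sideWeight h
  have hCD := sideWeight_nonneg C D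
  have hDC := sideWeight_nonneg D C
  obtain ⟨δ, hδ⟩ : ∃ δ : Edge R → ℚ, ∀ e, δ e = if eX R e.1.1 D < eX R e.1.1 C then
      sideWeight D C e else if eX R e.1.1 C < eX R e.1.1 D then sideWeight C D e else 0 :=
    ⟨_, fun _ => rfl⟩
  refine ordE_le_ordE_of_sideWeight_le R δ (fun e => ?_) (fun e => ?_) (fun x => ?_)
  · rcases lt_trichotomy (eX R e.1.1 C) (eX R e.1.1 D) with he | he | he
    · simp [hδ, he, he.not_gt, (sideWeight_alignSide_of_lt R he).2, hCD e]
    · simp [hδ, he, sideWeight_alignSide_of_eq R he.symm]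
    · simp [hδ, he, (sideWeight_alignSide_of_lt R he).1, hw e]
  · rcases lt_trichotomy (eX R e.1.1 C) (eX R e.1.1 D) with he | he | he
    · simp [hδ, he, he.not_gt, (sideWeight_alignSide_of_lt R he).1,
        add_comm (sideWeight D C e), hw e]
    · simp [hδ, he, sideWeight_alignSide_of_eq R he]
    · simp [hδ, he, (sideWeight_alignSide_of_lt R he).2, hDC e]
  · have congr_at {f g : Edge R → ℚ} (hfg : ∀ e : Edge R, e.1.1 = x → f e = g e) :
        ∑ e : Edge R with e.1.1 = x, f e = ∑ e : Edge R with e.1.1 = x, g e :=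
      Finset.sum_congr rfl fun e he => hfg e (Finset.mem_filter.1 he).2
    rcases lt_trichotomy (eX R x C) (eX R x D) with hx | hx | hx
    · rw [congr_at (f := sideWeight (alignSide R C D) _) (g := fun _ => 0)
          (by rintro e rfl; exact (sideWeight_alignSide_of_lt R hx).2),
        congr_at (f := δ) (g := sideWeight C D) (by rintro e rfl; simp [hδ, hx, hx.not_gt]),
        min_eq_left (sum_sideWeight_le_sum_sideWeight R hx.le), Finset.sum_const_zero]
      simp
    · rw [congr_at (f := sideWeight (alignSide R C D) _) (g := sideWeight C D)
          (by rintro e rfl; exact sideWeight_alignSide_of_eq R hx.symm),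
        congr_at (f := sideWeight (alignSide R D C) _) (g := sideWeight D C)
          (by rintro e rfl; exact sideWeight_alignSide_of_eq R hx),
        congr_at (f := δ) (g := fun _ => 0) (by rintro e rfl; simp [hδ, hx])]
      simp
    · rw [congr_at (f := sideWeight (alignSide R D C) _) (g := fun _ => 0)
          (by rintro e rfl; exact (sideWeight_alignSide_of_lt R hx).2),
        congr_at (f := δ) (g := sideWeight D C) (by rintro e rfl; simp [hδ, hx]),
        min_eq_right (sum_sideWeight_le_sum_sideWeight R hx.le), Finset.sum_const_zero]
      simp

end alignSide

/-- Every separation of `E` can be replaced by one of no larger order and with the same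
shift, in which all edges incident with `C^◀_D ∖ D^◀_C` lie in `C' ∖ D'` and all edges
incident with `D^◀_C ∖ C^◀_D` lie in `D' ∖ C'`. -/
theorem minimal_induced (R : X → Y → Prop) [∀ x y, Decidable (R x y)]
    (C D : Finset (Edge R)) (h : C ∪ D = univ) :
    ∃ C' D' : Finset (Edge R), C' ∪ D' = univ ∧
      ordE R C' D' ≤ ordE R C D ∧
      bshift1 R C' D' = bshift1 R C D ∧ bshift2 R C' D' = bshift2 R C D ∧
      (∀ e : Edge R, e.1.1 ∈ bshift1 R C D \ bshift2 R C D → e ∈ C' \ D') ∧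
      (∀ e : Edge R, e.1.1 ∈ bshift2 R C D \ bshift1 R C D → e ∈ D' \ C') := by
  refine ⟨alignSide R C D, alignSide R D C, alignSide_union_alignSide R h, ordE_alignSide_le R h,
    ?_, ?_, fun e he => ?_, fun e he => ?_⟩
  · simp only [bshift1, eX_alignSide_le_iff]
  · simp only [bshift2, eX_alignSide_le_iff]
  all_goals
    simp only [bshift1, bshift2, mem_sdiff, mem_filter, mem_univ, true_and] at he
    simp only [mem_sdiff, mem_alignSide]
    omega

end BipSep
end

section
/- Let (C,D) be a separation of E and let e ∈ E be an edge whose endpoint in X lies in C^◀_D. Then |C ∪ {e}, D|_E ≤ |C,D|_E and (C,D)^◀ ≤ (C ∪ {e}, D)^◀. -/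
open Finset

namespace BipSep

variable {X Y : Type*} [Fintype X] [Fintype Y] [DecidableEq X] [DecidableEq Y]

lemma eX_insert (R : X → Y → Prop) [∀ x y, Decidable (R x y)] (x : X) {C : Finset (Edge R)}
    {e : Edge R} (he : e ∉ C) :
    eX R x (insert e C) = eX R x C + if e.1.1 = x then 1 else 0 := by
  unfold eX
  rw [filter_insert]
  split_ifs with hx
  · rw [card_insert_of_notMem (by simp [he])]
  · rfl

lemma eY_insert (R : X → Y → Prop) [∀ x y, Decidable (R x y)] (y : Y) {C : Finset (Edge R)}
    {e : Edge R} (he : e ∉ C) :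
    eY R y (insert e C) = eY R y C + if e.1.2 = y then 1 else 0 := by
  unfold eY
  rw [filter_insert]
  split_ifs with hy
  · rw [card_insert_of_notMem (by simp [he])]
  · rfl

lemma eX_mono (R : X → Y → Prop) [∀ x y, Decidable (R x y)] (x : X) {C D : Finset (Edge R)}
    (h : C ⊆ D) : eX R x C ≤ eX R x D :=
  card_le_card (filter_subset_filter _ h)

lemma ordE_insert_le (R : X → Y → Prop) [∀ x y, Decidable (R x y)] {C D : Finset (Edge R)}
    {e : Edge R} (heC : e ∉ C) (heD : e ∈ D) (he : eX R e.1.1 D ≤ eX R e.1.1 C) :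
    ordE R (insert e C) D ≤ ordE R C D := by
  have heI : e ∉ C ∩ D := fun h => heC (mem_of_mem_inter_left h)
  have hX : ∑ x : X, ((min (eX R x (insert e C)) (eX R x D) : ℚ)
        - (eX R x (insert e C ∩ D) : ℚ) / 2) ≤
      ∑ x : X, (((min (eX R x C) (eX R x D) : ℚ) - (eX R x (C ∩ D) : ℚ) / 2)
        + if e.1.1 = x then (-1 / 2 : ℚ) else 0) := by
    refine sum_le_sum fun x _ => ?_
    rw [insert_inter_of_mem heD, eX_insert R x heC, eX_insert R x heI]
    split_ifs with hx
    · subst hx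
      have he' : (eX R e.1.1 D : ℚ) ≤ eX R e.1.1 C := by exact_mod_cast he
      push_cast
      rw [min_eq_right he', min_eq_right (he'.trans (by linarith))]
      linarith
    · simp
  have hY : ∑ y : Y, ((min (eY R y (insert e C)) (eY R y D) : ℚ)
        - (eY R y (insert e C ∩ D) : ℚ) / 2) ≤
      ∑ y : Y, (((min (eY R y C) (eY R y D) : ℚ) - (eY R y (C ∩ D) : ℚ) / 2)
        + if e.1.2 = y then (1 / 2 : ℚ) else 0) := by
    refine sum_le_sum fun y _ => ?_
    rw [insert_inter_of_mem heD, eY_insert R y heC, eY_insert R y heI]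
    split_ifs with hy
    · push_cast
      have : min ((eY R y C : ℚ) + 1) (eY R y D) ≤ min (eY R y C : ℚ) (eY R y D) + 1 := by
        rw [← min_add_add_right]
        exact min_le_min le_rfl (by linarith)
      linarith
    · simp
  rw [sum_add_distrib, sum_ite_eq] at hX hY
  simp only [mem_univ, if_true] at hX hY
  unfold ordE
  linarith

/-- Adding an edge incident with `C^◀_D` to `C` does not increase the order, and only
enlarges the shift. -/
theorem move_to_middle (R : X → Y → Prop) [∀ x y, Decidable (R x y)]
    (C D : Finset (Edge R)) (h : C ∪ D = univ) (e : Edge R)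
    (he : e.1.1 ∈ bshift1 R C D) :
    ordE R (insert e C) D ≤ ordE R C D ∧
      bshift1 R C D ⊆ bshift1 R (insert e C) D ∧
      bshift2 R (insert e C) D ⊆ bshift2 R C D := by
  have hle : ∀ x, eX R x C ≤ eX R x (insert e C) := fun x => eX_mono R x (subset_insert e C)
  refine ⟨?_, fun x hx => ?_, fun x hx => ?_⟩
  · by_cases heC : e ∈ C
    · rw [insert_eq_of_mem heC]
    · have heD : e ∈ D := (mem_union.1 (h ▸ mem_univ e)).resolve_left heC
      exact ordE_insert_le R heC heD (mem_filter.1 he).2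
  · exact mem_filter.2 ⟨mem_univ x, (mem_filter.1 hx).2.trans (hle x)⟩
  · exact mem_filter.2 ⟨mem_univ x, (hle x).trans (mem_filter.1 hx).2⟩

end BipSep
end

section
/- Let k > 0, assume that every vertex of G is incident with at least one edge and that G has at least 8k edges. If τ is a tangle of S_{4k}(X), then τ_E ∩ S_k(E) is a tangle of S_k(E), where τ_E := {(C,D) : (C,D) a separation of E with (C,D)^◀ ∈ τ}. -/
open Finset

namespace BipSep

variable {X Y : Type*} [Fintype X] [Fintype Y] [DecidableEq X] [DecidableEq Y]

/-- The number of neighbours of `y` in `A`, as a sum over the edges at `y`. -/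
lemma nX_eq_sum (R : X → Y → Prop) [∀ x y, Decidable (R x y)] (y : Y) (A : Finset X) :
    (nX R y A : ℚ) = ∑ e : Edge R with e.1.2 = y, if e.1.1 ∈ A then 1 else 0 := by
  rw [Finset.sum_boole, Finset.filter_filter, nX]
  congr 1
  refine (Finset.card_bij (fun e _ => e.1.1) ?_ ?_ ?_).symm
  · rintro ⟨⟨x, y'⟩, h⟩ he
    simp only [mem_filter, mem_univ, true_and] at he ⊢
    obtain ⟨rfl, hA⟩ := he
    exact ⟨hA, h⟩
  · rintro ⟨⟨x, y₁⟩, h₁⟩ he₁ ⟨⟨x₂, y₂⟩, h₂⟩ he₂ hx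
    simp only [mem_filter, mem_univ, true_and] at he₁ he₂ hx
    obtain ⟨rfl, -⟩ := he₁
    obtain ⟨rfl, -⟩ := he₂
    subst hx
    rfl
  · intro x hx
    simp only [mem_filter] at hx
    exact ⟨⟨(x, y), hx.2⟩, by simp [hx.1], rfl⟩

lemma eX_eq_sum (R : X → Y → Prop) [∀ x y, Decidable (R x y)] (x : X) (C : Finset (Edge R)) :
    (eX R x C : ℚ) = ∑ e : Edge R with e.1.1 = x, if e ∈ C then 1 else 0 := by
  rw [Finset.sum_boole, eX]
  congr 2
  ext e
  simp [and_comm]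

lemma eY_eq_sum (R : X → Y → Prop) [∀ x y, Decidable (R x y)] (y : Y) (C : Finset (Edge R)) :
    (eY R y C : ℚ) = ∑ e : Edge R with e.1.2 = y, if e ∈ C then 1 else 0 := by
  rw [Finset.sum_boole, eY]
  congr 2
  ext e
  simp [and_comm]

lemma ordE_comm (R : X → Y → Prop) [∀ x y, Decidable (R x y)] (C D : Finset (Edge R)) :
    ordE R C D = ordE R D C := by
  simp only [ordE, min_comm, Finset.inter_comm]

lemma bshift_union (R : X → Y → Prop) [∀ x y, Decidable (R x y)] (C D : Finset (Edge R)) :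
    bshift1 R C D ∪ bshift2 R C D = univ := by
  ext x
  simp [bshift1, bshift2, le_total]

/-- The contribution of a single edge to the order of `(C, D)` at its endpoint in `X`, such that
ties are split evenly between `C` and `D`. -/
def edgeWeight (R : X → Y → Prop) [∀ x y, Decidable (R x y)] (C D : Finset (Edge R))
    (e : Edge R) : ℚ :=
  (if eX R e.1.1 C < eX R e.1.1 D then (if e ∈ C then 1 else 0)
    else if eX R e.1.1 D < eX R e.1.1 C then (if e ∈ D then 1 else 0)
    else ((if e ∈ C then 1 else 0) + (if e ∈ D then 1 else 0)) / 2)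
    - (if e ∈ C ∩ D then 1 else 0) / 2

lemma sum_edgeWeight (R : X → Y → Prop) [∀ x y, Decidable (R x y)] (C D : Finset (Edge R))
    (x : X) :
    ∑ e : Edge R with e.1.1 = x, edgeWeight R C D e =
      (min (eX R x C) (eX R x D) : ℚ) - (eX R x (C ∩ D) : ℚ) / 2 := by
  have key : ∀ e ∈ univ.filter (fun e : Edge R => e.1.1 = x), edgeWeight R C D e =
      (if eX R x C < eX R x D then (if e ∈ C then 1 else 0)
        else if eX R x D < eX R x C then (if e ∈ D then 1 else 0)
        else ((if e ∈ C then 1 else 0) + (if e ∈ D then 1 else 0)) / 2)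
        - (if e ∈ C ∩ D then 1 else 0) / 2 := by
    intro e he
    rw [mem_filter] at he
    rw [edgeWeight, he.2]
  rw [Finset.sum_congr rfl key, Finset.sum_sub_distrib, ← Finset.sum_div, ← eX_eq_sum]
  congr 1
  rcases lt_trichotomy (eX R x C) (eX R x D) with h | h | h
  · have h' : (eX R x C : ℚ) ≤ eX R x D := by exact_mod_cast h.le
    simp only [h, if_true, min_eq_left h', ← eX_eq_sum]
  · have h' : (eX R x C : ℚ) = eX R x D := by exact_mod_cast h
    simp only [h, lt_irrefl, if_false, min_self]
    rw [← Finset.sum_div, Finset.sum_add_distrib, ← eX_eq_sum, ← eX_eq_sum, h']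
    ring
  · have h' : (eX R x D : ℚ) ≤ eX R x C := by exact_mod_cast h.le
    simp only [h, h.not_gt, if_true, if_false, min_eq_right h', ← eX_eq_sum]

lemma edgeWeight_comm (R : X → Y → Prop) [∀ x y, Decidable (R x y)] (C D : Finset (Edge R))
    (e : Edge R) : edgeWeight R C D e = edgeWeight R D C e := by
  rw [edgeWeight, edgeWeight, Finset.inter_comm]
  rcases lt_trichotomy (eX R e.1.1 C) (eX R e.1.1 D) with h | h | h
  · simp only [h, h.not_gt, if_true, if_false]
  · simp only [h, lt_irrefl, if_false, add_comm]
  · simp only [h, h.not_gt, if_true, if_false]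

lemma bshift_edge_le (R : X → Y → Prop) [∀ x y, Decidable (R x y)] (C D : Finset (Edge R))
    (hCD : C ∪ D = univ) (e : Edge R) :
    ((if e.1.1 ∈ bshift1 R C D then 1 else 0 : ℚ)
        - (if e.1.1 ∈ bshift1 R C D ∩ bshift2 R C D then 1 else 0) / 2) ≤
      edgeWeight R C D e + ((if e ∈ C then 1 else 0) - (if e ∈ C ∩ D then 1 else 0) / 2) := by
  have hmem : (e ∈ C ∧ e ∈ D) ∨ (e ∈ C ∧ e ∉ D) ∨ (e ∉ C ∧ e ∈ D) := by
    have : e ∈ C ∨ e ∈ D := by rw [← mem_union, hCD]; exact mem_univ e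
    tauto
  simp only [edgeWeight, bshift1, bshift2, mem_inter, mem_filter, mem_univ, true_and, ← not_lt]
  rcases lt_trichotomy (eX R e.1.1 C) (eX R e.1.1 D) with h | h | h <;>
  rcases hmem with ⟨hC, hD⟩ | ⟨hC, hD⟩ | ⟨hC, hD⟩ <;>
  simp only [hC, hD, h, h.not_gt, lt_irrefl, not_true, not_false_iff, if_true, if_false,
    and_true, and_false, and_self] <;>
  norm_num

lemma ordX_bshift_term_le (R : X → Y → Prop) [∀ x y, Decidable (R x y)] (C D : Finset (Edge R))
    (hCD : C ∪ D = univ) (y : Y) :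
    (min (nX R y (bshift1 R C D)) (nX R y (bshift2 R C D)) : ℚ)
        - (nX R y (bshift1 R C D ∩ bshift2 R C D) : ℚ) / 2 ≤
      (∑ e : Edge R with e.1.2 = y, edgeWeight R C D e) +
        ((min (eY R y C) (eY R y D) : ℚ) - (eY R y (C ∩ D) : ℚ) / 2) := by
  wlog h : (eY R y C : ℚ) ≤ eY R y D generalizing C D
  · have := this D C (by rw [Finset.union_comm, hCD]) (le_of_not_ge h)
    simp only [edgeWeight_comm R D C] at this
    rw [Finset.inter_comm C D, min_comm (eY R y C : ℚ), Finset.inter_comm (bshift1 R C D),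
      min_comm (nX R y (bshift1 R C D) : ℚ)]
    exact this
  rw [min_eq_left h]
  refine (sub_le_sub_right (min_le_left _ _) _).trans ?_
  simp only [nX_eq_sum, eY_eq_sum, Finset.sum_div]
  rw [← Finset.sum_sub_distrib, ← Finset.sum_sub_distrib, ← Finset.sum_add_distrib]
  exact Finset.sum_le_sum fun e _ => bshift_edge_le R C D hCD e

/-- Shifting a separation of the edges to the vertices does not increase its order. -/
lemma ordX_bshift_le (R : X → Y → Prop) [∀ x y, Decidable (R x y)] (C D : Finset (Edge R))
    (hCD : C ∪ D = univ) :
    ordX R (bshift1 R C D) (bshift2 R C D) ≤ ordE R C D := by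
  refine (Finset.sum_le_sum fun y _ => ordX_bshift_term_le R C D hCD y).trans ?_
  rw [Finset.sum_add_distrib, Finset.sum_fiberwise, ordE,
    ← Finset.sum_fiberwise univ (fun e : Edge R => e.1.1)]
  simp only [sum_edgeWeight, le_refl]

/-- Adding a set `S` disjoint from `A` to the first side of a separation `(A, B)` increases its
order by at most half the number of edges at `S`. -/
lemma ordX_union_le (R : X → Y → Prop) [∀ x y, Decidable (R x y)] {A B S : Finset X}
    (hAB : A ∪ B = univ) (hS : Disjoint A S) :
    ordX R (A ∪ S) B ≤ ordX R A B + (∑ y : Y, (nX R y S : ℚ)) / 2 := by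
  have hSB : S ⊆ B := fun x hx => by
    have : x ∈ A ∪ B := hAB ▸ mem_univ x
    exact (mem_union.1 this).resolve_left (Finset.disjoint_right.1 hS hx)
  have hadd : ∀ (y : Y) (U V : Finset X), Disjoint U V →
      (nX R y (U ∪ V) : ℚ) = nX R y U + nX R y V := fun y U V h => by
    rw [nX, Finset.filter_union, Finset.card_union_of_disjoint (Finset.disjoint_filter_filter h)]
    push_cast
    rfl
  have hinter : (A ∪ S) ∩ B = (A ∩ B) ∪ S := by
    rw [Finset.union_inter_distrib_right, Finset.inter_eq_left.2 hSB]
  rw [ordX, ordX, Finset.sum_div, ← Finset.sum_add_distrib]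
  refine Finset.sum_le_sum fun y _ => ?_
  rw [hinter, hadd y A S hS, hadd y (A ∩ B) S (hS.mono_left inter_subset_left)]
  have h0 : (0 : ℚ) ≤ nX R y S := Nat.cast_nonneg _
  have : min ((nX R y A : ℚ) + nX R y S) (nX R y B) ≤ min (nX R y A : ℚ) (nX R y B) + nX R y S := by
    rw [← min_add_add_right]
    exact min_le_min_left _ (by linarith)
  linarith

lemma eX_inter_le (R : X → Y → Prop) [∀ x y, Decidable (R x y)] (x : X)
    (C D : Finset (Edge R)) :
    (eX R x (C ∩ D) : ℚ) ≤ min (eX R x C : ℚ) (eX R x D) :=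
  le_min (by exact_mod_cast card_le_card (filter_subset_filter _ inter_subset_left))
    (by exact_mod_cast card_le_card (filter_subset_filter _ inter_subset_right))

lemma eY_inter_le (R : X → Y → Prop) [∀ x y, Decidable (R x y)] (y : Y)
    (C D : Finset (Edge R)) :
    (eY R y (C ∩ D) : ℚ) ≤ min (eY R y C : ℚ) (eY R y D) :=
  le_min (by exact_mod_cast card_le_card (filter_subset_filter _ inter_subset_left))
    (by exact_mod_cast card_le_card (filter_subset_filter _ inter_subset_right))

/-- At the vertices outside the shift of `C`, at most twice the order many edges lie in `C`. -/
lemma sum_eX_le_ordE (R : X → Y → Prop) [∀ x y, Decidable (R x y)] (C D : Finset (Edge R))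
    {S : Finset X} (hS : Disjoint (bshift1 R C D) S) :
    (∑ x ∈ S, (eX R x C : ℚ)) / 2 ≤ ordE R C D := by
  have hY : 0 ≤ ∑ y : Y, ((min (eY R y C) (eY R y D) : ℚ) - (eY R y (C ∩ D) : ℚ) / 2) :=
    Finset.sum_nonneg fun y _ => by
      have h₁ := eY_inter_le R y C D
      have h₂ : (0 : ℚ) ≤ eY R y (C ∩ D) := Nat.cast_nonneg _
      linarith
  have hX : (∑ x ∈ S, (eX R x C : ℚ)) / 2 ≤
      ∑ x : X, ((min (eX R x C) (eX R x D) : ℚ) - (eX R x (C ∩ D) : ℚ) / 2) := by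
    rw [Finset.sum_div]
    refine (Finset.sum_le_sum fun x hx => ?_).trans
      (Finset.sum_le_sum_of_subset_of_nonneg (subset_univ S) fun x _ _ => ?_)
    · have hlt : (eX R x C : ℚ) ≤ eX R x D := by
        have := Finset.disjoint_right.1 hS hx
        simp only [bshift1, mem_filter, mem_univ, true_and, not_le] at this
        exact_mod_cast this.le
      have h := eX_inter_le R x C D
      rw [min_eq_left hlt] at h ⊢
      linarith
    · have h₁ := eX_inter_le R x C D
      have h₂ : (0 : ℚ) ≤ eX R x (C ∩ D) := Nat.cast_nonneg _
      linarith
  rw [ordE]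
  linarith

/-- The number of edges at `S` is at most the sum of the numbers of those lying in each member of
a cover of the edge set. -/
lemma sum_nX_le_of_cover (R : X → Y → Prop) [∀ x y, Decidable (R x y)]
    {C₁ C₂ C₃ : Finset (Edge R)} (h : C₁ ∪ C₂ ∪ C₃ = univ) (S : Finset X) :
    ∑ y : Y, (nX R y S : ℚ) ≤
      ∑ x ∈ S, (eX R x C₁ : ℚ) + ∑ x ∈ S, (eX R x C₂ : ℚ) + ∑ x ∈ S, (eX R x C₃ : ℚ) := by
  have hedge : ∑ y : Y, (nX R y S : ℚ) = ∑ x ∈ S, (eX R x univ : ℚ) := by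
    simp only [nX_eq_sum, eX_eq_sum, mem_univ, if_true]
    rw [Finset.sum_fiberwise, ← Finset.sum_fiberwise univ (fun e : Edge R => e.1.1)]
    rw [← Finset.sum_subset (subset_univ S)]
    · refine Finset.sum_congr rfl fun x hx => Finset.sum_congr rfl fun e he => ?_
      rw [if_pos ((mem_filter.1 he).2 ▸ hx)]
    · intro x _ hx
      refine Finset.sum_eq_zero fun e he => ?_
      rw [if_neg ((mem_filter.1 he).2 ▸ hx)]
  rw [hedge, ← Finset.sum_add_distrib, ← Finset.sum_add_distrib]
  refine Finset.sum_le_sum fun x _ => ?_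
  have : eX R x univ ≤ eX R x C₁ + eX R x C₂ + eX R x C₃ := by
    rw [← h]
    simp only [eX, Finset.filter_union]
    exact (card_union_le _ _).trans (Nat.add_le_add_right (card_union_le _ _) _)
  exact_mod_cast this

/-- If `τ` is a tangle of `S_{4k}(X)`, then `τ_E ∩ S_k(E)` is a tangle of `S_k(E)`. -/
theorem vtx_to_edges (R : X → Y → Prop) [∀ x y, Decidable (R x y)] (k : ℚ) (hk : 0 < k)
    (hdegX : ∀ x : X, ∃ y : Y, R x y) (hdegY : ∀ y : Y, ∃ x : X, R x y)
    (hE : 8 * k ≤ (Fintype.card (Edge R) : ℚ))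
    (τ : Set (Finset X × Finset X)) (hτ : IsTangle (ordX R) (4 * k) τ) :
    IsTangle (ordE R) k (pullE R τ ∩ Sk (ordE R) k) := by
  have hord : ∀ C D : Finset (Edge R), C ∪ D = univ → ordE R C D < k →
      ordX R (bshift1 R C D) (bshift2 R C D) < k := fun C D h h' =>
    (ordX_bshift_le R C D h).trans_lt h'
  refine ⟨fun p hp => hp.2, fun C D hCD hlt => ?_, ?_⟩
  · have hDC : D ∪ C = univ := by rw [Finset.union_comm, hCD]
    have hlt' : ordE R D C < k := by rwa [ordE_comm]
    have hiff := hτ.2.1 _ _ (bshift_union R C D) ((hord C D hCD hlt).trans (by linarith))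
    have h₁ : (C, D) ∈ pullE R τ ∩ Sk (ordE R) k ↔ (bshift1 R C D, bshift2 R C D) ∈ τ :=
      ⟨fun h => h.1.2, fun h => ⟨⟨hCD, h⟩, hCD, hlt⟩⟩
    have h₂ : (D, C) ∈ pullE R τ ∩ Sk (ordE R) k ↔ (bshift2 R C D, bshift1 R C D) ∈ τ :=
      ⟨fun h => h.1.2, fun h => ⟨⟨hDC, h⟩, hDC, hlt'⟩⟩
    rw [h₁, h₂, hiff]
  · rintro ⟨C₁, D₁⟩ ⟨⟨hu₁, ht₁⟩, -, hk₁⟩ ⟨C₂, D₂⟩ ⟨⟨-, ht₂⟩, -, hk₂⟩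
      ⟨C₃, D₃⟩ ⟨⟨-, ht₃⟩, -, hk₃⟩ hcov
    dsimp only at hu₁ ht₁ hk₁ ht₂ hk₂ ht₃ hk₃ hcov
    set A₁ := bshift1 R C₁ D₁
    set B₁ := bshift2 R C₁ D₁
    set A₂ := bshift1 R C₂ D₂
    set A₃ := bshift1 R C₃ D₃
    set S := univ \ (A₁ ∪ A₂ ∪ A₃) with hSdef
    have hdisj : Disjoint (A₁ ∪ A₂ ∪ A₃) S := Finset.disjoint_sdiff
    have hd₁ : Disjoint A₁ S := hdisj.mono_left (subset_union_left.trans subset_union_left)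
    have hd₂ : Disjoint A₂ S := hdisj.mono_left (subset_union_right.trans subset_union_left)
    have hd₃ : Disjoint A₃ S := hdisj.mono_left subset_union_right
    have hAB : A₁ ∪ B₁ = univ := bshift_union R C₁ D₁
    have hlt : ordX R (A₁ ∪ S) B₁ < 4 * k := by
      have h₀ := ordX_union_le R hAB hd₁
      have h₁ := sum_eX_le_ordE R C₁ D₁ hd₁
      have h₂ := sum_eX_le_ordE R C₂ D₂ hd₂
      have h₃ := sum_eX_le_ordE R C₃ D₃ hd₃
      have h₄ := sum_nX_le_of_cover R hcov S
      have h₅ : ordX R A₁ B₁ < k := hord C₁ D₁ hu₁ hk₁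
      linarith
    have hASB : (A₁ ∪ S) ∪ B₁ = univ := by
      rw [Finset.union_right_comm, hAB, Finset.union_eq_left.2 (subset_univ _)]
    have hmem : (A₁ ∪ S, B₁) ∈ τ := by
      refine (hτ.2.1 _ _ hASB hlt).2 fun h => hτ.2.2 _ ht₁ _ h _ h ?_
      rw [hAB, Finset.union_eq_left.2 (subset_univ _)]
    refine hτ.2.2 _ hmem _ ht₂ _ ht₃ ?_
    change A₁ ∪ S ∪ A₂ ∪ A₃ = univ
    rw [Finset.union_right_comm A₁ S A₂, Finset.union_right_comm _ S A₃, hSdef]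
    exact Finset.union_sdiff_of_subset (subset_univ _)

end BipSep
end
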